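/- Consider four masses (m̄, m, m, m) with m̄, m > 0 on S^2 ⊂ ℝ³. If m̄/m ∈ (0, 16/(9√3)], then there exists c ∈ (0,1) such that the configuration q_c = ((1,0,0), (−c, r, 0), (−c, −r/2, (√3/2)r), (−c, −r/2, −(√3/2)r)) with r = √(1−c²) is a special central configuration for these masses. If moreover m̄/m ∈ (√3/3, 16/(9√3)), then there exist two distinct values c_1 ≠ c_2 in (0,1) such that both q_{c_1} and q_{c_2} are special central configurations for these masses; in particular there are at least two special central configurations for four equal masses. -/

import Mathlib

open Real Matrix Finset

/-- The configuration q_c: one body at (1,0,0), three on an equilateral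
triangle at height −c on S². -/
noncomputable def qc (c : ℝ) : Fin 4 → Fin 3 → ℝ :=
  ![![1, 0, 0],
    ![-c, Real.sqrt (1 - c ^ 2), 0],
    ![-c, -(Real.sqrt (1 - c ^ 2) / 2), Real.sqrt 3 / 2 * Real.sqrt (1 - c ^ 2)],
    ![-c, -(Real.sqrt (1 - c ^ 2) / 2), -(Real.sqrt 3 / 2 * Real.sqrt (1 - c ^ 2))]]

theorem qc_dotProduct (c : ℝ) (hc : c ∈ Set.Ioo (0 : ℝ) 1) (i j : Fin 4) :
    qc c i ⬝ᵥ qc c j =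
      if i = j then 1 else if i = 0 ∨ j = 0 then -c else (3 * c ^ 2 - 1) / 2 := by
  have hr : √(1 - c ^ 2) ^ 2 = 1 - c ^ 2 := Real.sq_sqrt (by nlinarith [hc.1, hc.2])
  have hs : √3 ^ 2 = (3 : ℝ) := Real.sq_sqrt (by norm_num)
  fin_cases i <;> fin_cases j <;> simp [qc, dotProduct, Fin.sum_univ_three] <;> grind

/-- The mass ratio `m̄ / m` for which `qc c` is a special central configuration. -/
noncomputable def massRatio (c : ℝ) : ℝ := 8 * c / (√3 * √(1 + 3 * c ^ 2) ^ 3)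

theorem continuous_massRatio : Continuous massRatio := by
  unfold massRatio
  refine Continuous.div (by fun_prop) (by fun_prop) fun c => ?_
  have : 0 < 1 + 3 * c ^ 2 := by positivity
  positivity

theorem massRatio_zero : massRatio 0 = 0 := by simp [massRatio]

theorem massRatio_one : massRatio 1 = √3 / 3 := by
  have h4 : √(1 + 3 * 1 ^ 2) = (2 : ℝ) := by
    rw [show (1 + 3 * 1 ^ 2 : ℝ) = 2 ^ 2 by norm_num, Real.sqrt_sq (by norm_num)]
  have hs : √3 ^ 2 = (3 : ℝ) := Real.sq_sqrt (by norm_num)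
  rw [massRatio, h4]
  field_simp
  linarith

theorem massRatio_sqrt_six_div_six : massRatio (√6 / 6) = 16 / (9 * √3) := by
  have h6 : √6 ^ 2 = (6 : ℝ) := Real.sq_sqrt (by norm_num)
  have hS : √(1 + 3 * (√6 / 6) ^ 2) = √6 / 2 := by
    rw [Real.sqrt_eq_iff_mul_self_eq (by positivity) (by positivity)]
    grind
  rw [massRatio, hS]
  field_simp
  linarith

theorem sqrt_six_div_six_mem_Ioo : √6 / 6 ∈ Set.Ioo (0 : ℝ) 1 := by
  have h6 : √6 < 6 := by
    rw [Real.sqrt_lt' (by norm_num)]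
    norm_num
  exact ⟨by positivity, by linarith⟩

/-- The configuration `qc c` is a special central configuration when the mass ratio is
`massRatio c`. -/
theorem qc_special_central {mbar m c : ℝ} (hm : 0 < m) (hc : c ∈ Set.Ioo (0 : ℝ) 1)
    (h : massRatio c = mbar / m) (i : Fin 4) :
    (∑ j ∈ Finset.univ.erase i,
      ((![mbar, m, m, m] i * ![mbar, m, m, m] j) /
          (Real.sqrt (1 - (qc c i ⬝ᵥ qc c j) ^ 2)) ^ 3) •
        (qc c j - (qc c i ⬝ᵥ qc c j) • qc c i)) = 0 := by
  have hpos : 0 < 1 - c ^ 2 := by nlinarith [hc.1, hc.2]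
  have hr : √(1 - c ^ 2) ^ 2 = 1 - c ^ 2 := Real.sq_sqrt hpos.le
  have hs : √3 ^ 2 = (3 : ℝ) := Real.sq_sqrt (by norm_num)
  have hS : √(1 + 3 * c ^ 2) ^ 2 = 1 + 3 * c ^ 2 := Real.sq_sqrt (by positivity)
  have hS0 : 0 < √(1 + 3 * c ^ 2) := Real.sqrt_pos.2 (by positivity)
  have hr0 : 0 < √(1 - c ^ 2) := Real.sqrt_pos.2 hpos
  have hd : √(1 - ((3 * c ^ 2 - 1) / 2) ^ 2) =
      √3 / 2 * √(1 - c ^ 2) * √(1 + 3 * c ^ 2) := by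
    rw [show 1 - ((3 * c ^ 2 - 1) / 2) ^ 2 =
        (√3 / 2 * √(1 - c ^ 2) * √(1 + 3 * c ^ 2)) ^ 2 by
      rw [mul_pow, mul_pow, div_pow √3, hs, hr, hS]; ring, Real.sqrt_sq (by positivity)]
  have hw : mbar * m / √(1 - c ^ 2) ^ 3 =
      3 * c * (m * m / √(1 - ((3 * c ^ 2 - 1) / 2) ^ 2) ^ 3) := by
    rw [hd, show mbar = massRatio c * m by rw [h]; field_simp, massRatio]
    field_simp
    linear_combination 8 * c * hs
  rw [Finset.sum_erase _ (by rw [qc_dotProduct c hc]; simp), Fin.sum_univ_four]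
  simp only [qc_dotProduct c hc]
  ext k
  generalize hW : m * m / √(1 - ((3 * c ^ 2 - 1) / 2) ^ 2) ^ 3 = W at hw
  have hw' : m * mbar / √(1 - c ^ 2) ^ 3 = 3 * c * W := by rw [mul_comm m, hw]
  fin_cases i <;> fin_cases k <;> simp [qc, hw, hw', hW] <;> grind

/-- For masses (m̄, m, m, m) on S²: if m̄/m ∈ (0, 16/(9√3)] there is at least one
special central configuration of the form q_c, and if m̄/m ∈ (√3/3, 16/(9√3))
there are at least two; in particular four equal masses admit at least two. -/
theorem stmt17 (mbar m : ℝ) (hmbar : 0 < mbar) (hm : 0 < m) :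
    (mbar / m ∈ Set.Ioc (0 : ℝ) (16 / (9 * Real.sqrt 3)) →
      ∃ c ∈ Set.Ioo (0 : ℝ) 1,
        ∀ i, (∑ j ∈ Finset.univ.erase i,
            ((![mbar, m, m, m] i * ![mbar, m, m, m] j) /
                (Real.sqrt (1 - (qc c i ⬝ᵥ qc c j) ^ 2)) ^ 3) •
              (qc c j - (qc c i ⬝ᵥ qc c j) • qc c i)) = 0) ∧
    (mbar / m ∈ Set.Ioo (Real.sqrt 3 / 3) (16 / (9 * Real.sqrt 3)) →
      ∃ c₁ ∈ Set.Ioo (0 : ℝ) 1, ∃ c₂ ∈ Set.Ioo (0 : ℝ) 1, c₁ ≠ c₂ ∧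
        (∀ i, (∑ j ∈ Finset.univ.erase i,
            ((![mbar, m, m, m] i * ![mbar, m, m, m] j) /
                (Real.sqrt (1 - (qc c₁ i ⬝ᵥ qc c₁ j) ^ 2)) ^ 3) •
              (qc c₁ j - (qc c₁ i ⬝ᵥ qc c₁ j) • qc c₁ i)) = 0) ∧
        (∀ i, (∑ j ∈ Finset.univ.erase i,
            ((![mbar, m, m, m] i * ![mbar, m, m, m] j) /
                (Real.sqrt (1 - (qc c₂ i ⬝ᵥ qc c₂ j) ^ 2)) ^ 3) •
              (qc c₂ j - (qc c₂ i ⬝ᵥ qc c₂ j) • qc c₂ i)) = 0)) := by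
  have ha := sqrt_six_div_six_mem_Ioo
  refine ⟨fun h => ?_, fun h => ?_⟩
  · obtain ⟨c, hc, hcm⟩ := intermediate_value_Ioc ha.1.le continuous_massRatio.continuousOn
      (by rwa [massRatio_zero, massRatio_sqrt_six_div_six])
    have hc' : c ∈ Set.Ioo (0 : ℝ) 1 := ⟨hc.1, hc.2.trans_lt ha.2⟩
    exact ⟨c, hc', qc_special_central hm hc' hcm⟩
  · obtain ⟨c₁, hc₁, hcm₁⟩ := intermediate_value_Ioo ha.1.le continuous_massRatio.continuousOn
      (by rw [massRatio_zero, massRatio_sqrt_six_div_six]; exact ⟨div_pos hmbar hm, h.2⟩)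
    obtain ⟨c₂, hc₂, hcm₂⟩ := intermediate_value_Ioo' ha.2.le continuous_massRatio.continuousOn
      (by rwa [massRatio_one, massRatio_sqrt_six_div_six])
    have hc₁' : c₁ ∈ Set.Ioo (0 : ℝ) 1 := ⟨hc₁.1, hc₁.2.trans ha.2⟩
    have hc₂' : c₂ ∈ Set.Ioo (0 : ℝ) 1 := ⟨ha.1.trans hc₂.1, hc₂.2⟩
    exact ⟨c₁, hc₁', c₂, hc₂', (hc₁.2.trans hc₂.1).ne,
      qc_special_central hm hc₁' hcm₁, qc_special_central hm hc₂' hcm₂⟩
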